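/- arXiv:2503.16105 — 2 statements merged into one kernel-verified Lean document; each statement's English description precedes it below -/
import Mathlib

section
/- Nonsmooth mountain pass theorem without compactness: Let (E, ‖·‖) be a real Banach space, Ψ : E → (−∞, +∞] a proper convex function, 𝒢 : E → ℝ continuously Fréchet differentiable, and set I := Ψ − 𝒢. Assume: (i) Dom(Ψ) := {v ∈ E : Ψ(v) < +∞} is closed and the restriction of Ψ to Dom(Ψ) is continuous; (ii) I(0) = 0 and there exists ρ > 0 such that I(u) > 0 for every u ∈ E with 0 < ‖u‖ ≤ ρ; (iii) there exists e ∈ E with ‖e‖ > ρ and I(e) ≤ 0. Let Γ := {γ ∈ C([0,1]; E) : γ(0) = 0 ≠ γ(1) and I(γ(1)) ≤ 0} and c := inf_{γ∈Γ} sup_{t∈[0,1]} I(γ(t)). Then c is finite and there exist a sequence (u_n) ⊂ Dom(Ψ) and a sequence ε_n ≥ 0 with ε_n → 0 such that I(u_n) → c and, for every n and every v ∈ E, Ψ(u_n) − Ψ(v) − 𝒢′(u_n)[u_n − v] ≤ ε_n ‖u_n − v‖. -/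
open Filter Topology

lemma ekeland_aux {X : Type*} [MetricSpace X] [CompleteSpace X] (Φ : X → ℝ)
    (hlsc : LowerSemicontinuous Φ) (b : ℝ) (hb : ∀ x, b ≤ Φ x) (ε : ℝ) (hε : 0 < ε) (x₀ : X) :
    ∃ x, Φ x ≤ Φ x₀ ∧ ∀ y, Φ x - ε * dist x y ≤ Φ y := by
  let Sx : X → Set X := fun x => {y | Φ y + ε * dist x y ≤ Φ x}
  have hstep : ∀ (n : ℕ) (x : X), ∃ z ∈ Sx x, ∀ y ∈ Sx x, Φ z ≤ Φ y + (1/2 : ℝ)^n := by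
    intro n x
    have hne : (Φ '' Sx x).Nonempty := ⟨Φ x, x, by simp [Sx], rfl⟩
    have hbd : BddBelow (Φ '' Sx x) := ⟨b, by rintro _ ⟨y, -, rfl⟩; exact hb y⟩
    obtain ⟨_, ⟨z, hz, rfl⟩, hlt⟩ := exists_lt_of_csInf_lt hne
      (lt_add_of_pos_right (sInf (Φ '' Sx x)) (by positivity : (0:ℝ) < (1/2 : ℝ)^n))
    refine ⟨z, hz, fun y hy => ?_⟩
    have := csInf_le hbd ⟨y, hy, rfl⟩
    linarith
  choose f hf1 hf2 using hstep
  let x : ℕ → X := fun n => Nat.rec x₀ (fun n z => f n z) n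
  have hx : ∀ n, x (n+1) = f n (x n) := fun n => rfl
  have hmono : ∀ n m, n ≤ m → Φ (x m) + ε * dist (x n) (x m) ≤ Φ (x n) := by
    intro n m hnm
    induction m, hnm using Nat.le_induction with
    | base => simp
    | succ m hm ih =>
      have h1 : Φ (x (m+1)) + ε * dist (x m) (x (m+1)) ≤ Φ (x m) := hf1 m (x m)
      have h2 := dist_triangle (x n) (x m) (x (m+1))
      nlinarith
  have hanti : Antitone (fun n => Φ (x n)) := by
    intro n m hnm
    have := hmono n m hnm
    have := mul_nonneg hε.le (dist_nonneg (x := x n) (y := x m))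
    simp only
    linarith
  have hbdd : BddBelow (Set.range fun n => Φ (x n)) := ⟨b, by rintro _ ⟨y, rfl⟩; exact hb _⟩
  have htend := tendsto_atTop_ciInf hanti hbdd
  set l := ⨅ n, Φ (x n) with hl
  have hcau : CauchySeq x := by
    refine cauchySeq_of_le_tendsto_0' (fun n => (Φ (x n) - l) / ε) (fun n m hnm => ?_) ?_
    · rw [le_div_iff₀ hε]
      have := hmono n m hnm
      have : l ≤ Φ (x m) := ciInf_le hbdd m
      nlinarith
    · have := (htend.sub_const l).div_const ε
      simpa using this
  obtain ⟨z, hz⟩ := cauchySeq_tendsto_of_complete hcau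
  have hzS : ∀ n, Φ z + ε * dist (x n) z ≤ Φ (x n) := by
    intro n
    have hc : LowerSemicontinuous (fun y => Φ y + ε * dist (x n) y) :=
      hlsc.add (by fun_prop : Continuous fun y => ε * dist (x n) y).lowerSemicontinuous
    have hcl := hc.isClosed_preimage (Φ (x n))
    exact hcl.mem_of_tendsto hz (eventually_atTop.2 ⟨n, fun m hm => hmono n m hm⟩)
  have hle : ∀ n, Φ z ≤ Φ (x n) := fun n => by
    have := hzS n
    have := mul_nonneg hε.le (dist_nonneg (x := x n) (y := z))
    linarith
  refine ⟨z, hle 0, fun y => ?_⟩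
  by_contra hcon
  push Not at hcon
  have key : ∀ n, Φ z ≤ Φ y + (1/2 : ℝ)^n := by
    intro n
    refine (hle (n+1)).trans (hf2 n (x n) y ?_)
    have := hzS n
    have h2 := dist_triangle (x n) z y
    change Φ y + ε * dist (x n) y ≤ Φ (x n)
    nlinarith
  have hlim : Tendsto (fun n : ℕ => Φ y + (1/2 : ℝ)^n) atTop (𝓝 (Φ y + 0)) :=
    tendsto_const_nhds.add (tendsto_pow_atTop_nhds_zero_of_lt_one (by norm_num) (by norm_num))
  have := ge_of_tendsto' hlim key
  have := mul_nonneg hε.le (dist_nonneg (x := z) (y := y))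
  linarith

lemma core_aux {E : Type*} [NormedAddCommGroup E] [NormedSpace ℝ E]
    (D : Set E) (ψ G : E → ℝ) (hconv : ConvexOn ℝ D ψ) (hcont : ContinuousOn ψ D)
    (hG : ContDiff ℝ 1 G) (γ : C(unitInterval, E)) (hγ : ∀ t, γ t ∈ D)
    (S δ ε : ℝ) (hδ : 0 < δ) (hε : 0 < ε) (hS : ∀ t, ψ (γ t) - G (γ t) ≤ S)
    (h0 : ψ (γ 0) - G (γ 0) < S - δ) (h1 : ψ (γ 1) - G (γ 1) < S - δ)
    (hE : ∀ η : C(unitInterval, E), (∀ t, η t ∈ D) → η 0 = γ 0 → η 1 = γ 1 →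
      ∃ t, S - ε * dist γ η ≤ ψ (η t) - G (η t)) :
    ∃ t, S - δ ≤ ψ (γ t) - G (γ t) ∧ ∀ v ∈ D,
      ψ (γ t) - ψ v - fderiv ℝ G (γ t) (γ t - v) ≤ 2 * ε * ‖γ t - v‖ := by
  by_contra hcon
  push Not at hcon
  have hψγ : Continuous fun s => ψ (γ s) := hcont.comp_continuous γ.continuous hγ
  have hGc : Continuous G := hG.continuous
  have hG' : Continuous (fderiv ℝ G) := hG.continuous_fderiv (by norm_num)
  have hJc : Continuous fun s => ψ (γ s) - G (γ s) := hψγ.sub (hGc.comp γ.continuous)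
  obtain ⟨w, hw⟩ := exists_continuous_forall_mem_convex_of_local_const
    (t := fun s : unitInterval => {v | v ∈ D ∧ (S - δ ≤ ψ (γ s) - G (γ s) →
      2 * ε * ‖γ s - v‖ < ψ (γ s) - ψ v - fderiv ℝ G (γ s) (γ s - v))})
    (by
      intro s x hx y hy a b ha hb hab
      refine ⟨hconv.1 hx.1 hy.1 ha hb hab, fun hs => ?_⟩
      have h1 := hx.2 hs
      have h2 := hy.2 hs
      have h3 := hconv.2 hx.1 hy.1 ha hb hab
      have he : γ s - (a • x + b • y) = a • (γ s - x) + b • (γ s - y) := by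
        rw [show b = 1 - a by linarith]
        module
      rw [he]
      have h4 : ‖a • (γ s - x) + b • (γ s - y)‖ ≤ a * ‖γ s - x‖ + b * ‖γ s - y‖ := by
        refine (norm_add_le _ _).trans ?_
        rw [norm_smul, norm_smul, Real.norm_of_nonneg ha, Real.norm_of_nonneg hb]
      simp only [map_add, map_smul, smul_eq_mul] at h3 ⊢
      have hb' : b = 1 - a := by linarith
      have h5 : 2 * ε * (a * ‖γ s - x‖ + b * ‖γ s - y‖) <
          a * (ψ (γ s) - ψ x - fderiv ℝ G (γ s) (γ s - x)) +
          b * (ψ (γ s) - ψ y - fderiv ℝ G (γ s) (γ s - y)) := by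
        rcases ha.eq_or_lt with h | h
        · subst h
          have : b = 1 := by linarith
          subst this
          linarith
        · nlinarith [mul_lt_mul_of_pos_left h1 h, mul_le_mul_of_nonneg_left h2.le hb]
      have h6 := mul_le_mul_of_nonneg_left h4 (by positivity : 0 ≤ 2 * ε)
      refine h6.trans_lt (h5.trans_le ?_)
      have : a * ψ (γ s) + b * ψ (γ s) = ψ (γ s) := by rw [← add_mul, hab, one_mul]
      linarith)
    (by
      intro s
      by_cases hs : S - δ ≤ ψ (γ s) - G (γ s)
      · obtain ⟨v, hv, hlt⟩ := hcon s hs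
        refine ⟨v, ?_⟩
        have c1 : Continuous fun s => 2 * ε * ‖γ s - v‖ := by fun_prop
        have c2 : Continuous fun s => ψ (γ s) - ψ v - fderiv ℝ G (γ s) (γ s - v) :=
          (hψγ.sub continuous_const).sub
            ((hG'.comp γ.continuous).clm_apply (γ.continuous.sub continuous_const))
        filter_upwards [c1.continuousAt.eventually_lt c2.continuousAt hlt] with y hy
        exact ⟨hv, fun _ => hy⟩
      · refine ⟨γ 0, ?_⟩
        push Not at hs
        filter_upwards [hJc.continuousAt.eventually_lt continuousAt_const hs] with y hy
        exact ⟨hγ 0, fun h => absurd h (not_le.2 hy)⟩)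
  have hMc : IsCompact {s : unitInterval | S - δ ≤ ψ (γ s) - G (γ s)} :=
    (isClosed_le continuous_const hJc).isCompact
  obtain ⟨m, hm, hmM⟩ := hMc.exists_forall_le' (f := fun s => ‖w s - γ s‖) (a := 0)
    (by fun_prop) (by
      intro s hs
      rw [norm_pos_iff, sub_ne_zero]
      intro h
      have := (hw s).2 hs
      rw [h] at this
      simp at this)
  -- uniform differentiability
  have hunif : ∃ r > 0, ∀ s, ∀ z, ‖z‖ < r →
      G (γ s) + fderiv ℝ G (γ s) z - ε / 2 * ‖z‖ ≤ G (γ s + z) := by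
    have hcomp : IsCompact (Set.range γ) := isCompact_range γ.continuous
    have := hcomp.uniformContinuousAt_of_continuousAt (fderiv ℝ G)
      (fun a _ => hG'.continuousAt) (Metric.dist_mem_uniformity (half_pos hε))
    obtain ⟨r, hr, hr'⟩ := Metric.mem_uniformity_dist.1 this
    refine ⟨r, hr, fun s z hz => ?_⟩
    have := (convex_ball (γ s) r).norm_image_sub_le_of_norm_fderiv_le' (𝕜 := ℝ) (f := G)
      (φ := fderiv ℝ G (γ s)) (C := ε / 2) (x := γ s) (y := γ s + z)
      (fun x _ => (hG.differentiable (by norm_num)) x)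
      (fun x hx => by
        have h := hr' (a := γ s) (b := x) (by rwa [dist_comm])
        have h := h ⟨s, rfl⟩
        simp only [Set.mem_ofPred_eq] at h
        rw [← dist_eq_norm, dist_comm]
        exact h.le)
      (Metric.mem_ball_self hr) (by simpa using hz)
    rw [add_sub_cancel_left, Real.norm_eq_abs] at this
    linarith [neg_abs_le (G (γ s + z) - G (γ s) - fderiv ℝ G (γ s) z)]
  obtain ⟨r, hr, hrG⟩ := hunif
  obtain ⟨h, hh, hhm, hhr, hhδ⟩ : ∃ h > 0, h ≤ m ∧ h < r ∧ 3 / 2 * ε * h ≤ δ / 2 := by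
    refine ⟨min m (min (r/2) (δ / (3 * ε))), by positivity, min_le_left _ _, ?_, ?_⟩
    · exact ((min_le_right _ _).trans (min_le_left _ _)).trans_lt (by linarith)
    · have : min m (min (r/2) (δ / (3 * ε))) ≤ δ / (3 * ε) :=
        (min_le_right _ _).trans (min_le_right _ _)
      rw [le_div_iff₀ (by positivity)] at this
      linarith
  let χ : unitInterval → ℝ := fun s => max 0 (min 1 ((ψ (γ s) - G (γ s) - S + δ) * (2 / δ)))
  have hχc : Continuous χ :=
    continuous_const.max (continuous_const.min (((hJc.sub continuous_const).add
      continuous_const).mul continuous_const))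
  have hχ0 : ∀ s, 0 ≤ χ s := fun s => le_max_left _ _
  have hχ1 : ∀ s, χ s ≤ 1 := fun s => max_le zero_le_one (min_le_left _ _)
  have hχz : ∀ s, ψ (γ s) - G (γ s) < S - δ → χ s = 0 := by
    intro s hs
    refine max_eq_left ((min_le_right _ _).trans ?_)
    exact mul_nonpos_of_nonpos_of_nonneg (by linarith) (by positivity)
  have hχo : ∀ s, S - δ / 2 ≤ ψ (γ s) - G (γ s) → χ s = 1 := by
    intro s hs
    have : 1 ≤ (ψ (γ s) - G (γ s) - S + δ) * (2 / δ) := by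
      rw [← mul_div_assoc, le_div_iff₀ hδ]; linarith
    simp [χ, min_eq_left this]
  let η : C(unitInterval, E) :=
    ⟨fun s => γ s + (h * χ s / max m ‖w s - γ s‖) • (w s - γ s), by
      have : ∀ s, max m ‖w s - γ s‖ ≠ 0 := fun s => (lt_max_of_lt_left hm).ne'
      fun_prop (disch := assumption)⟩
  have hη : ∀ s, η s = γ s + (h * χ s / max m ‖w s - γ s‖) • (w s - γ s) := fun s => rfl
  have hηeq : ∀ s, χ s = 0 → η s = γ s := fun s hs => by simp [hη, hs]
  have claim : ∀ s, η s ∈ D ∧ dist (γ s) (η s) ≤ h ∧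
      ψ (η s) - G (η s) ≤ ψ (γ s) - G (γ s) - 3 / 2 * ε * (h * χ s) := by
    intro s
    by_cases hs : S - δ ≤ ψ (γ s) - G (γ s)
    · have hN := hmM s hs
      have hws := (hw s).2 hs
      set N := ‖w s - γ s‖ with hNdef
      have hNpos : 0 < N := hm.trans_le hN
      set τ := h * χ s / N with hτ
      have hhχ : 0 ≤ h * χ s := mul_nonneg hh.le (hχ0 s)
      have hhχ1 : h * χ s ≤ h := mul_le_of_le_one_right hh.le (hχ1 s)
      have hτ0 : 0 ≤ τ := by positivity
      have hτ1 : τ ≤ 1 := by rw [hτ, div_le_one hNpos]; linarith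
      have hτN : τ * N = h * χ s := div_mul_cancel₀ _ hNpos.ne'
      have he : η s = γ s + τ • (w s - γ s) := by rw [hη, max_eq_right hN]
      have he2 : η s = (1 - τ) • γ s + τ • w s := by rw [he]; module
      have hz : ‖τ • (w s - γ s)‖ = h * χ s := by
        rw [norm_smul, Real.norm_of_nonneg hτ0, ← hτN]
      refine ⟨?_, ?_, ?_⟩
      · rw [he2]; exact hconv.1 (hγ s) (hw s).1 (by linarith) hτ0 (by ring)
      · rw [he, dist_self_add_right, hz]; exact hhχ1
      · have g1 := hrG s (τ • (w s - γ s)) (by rw [hz]; linarith)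
        rw [← he, hz, map_smul, smul_eq_mul] at g1
        have g2 := hconv.2 (hγ s) (hw s).1 (by linarith : 0 ≤ 1 - τ) hτ0 (by ring)
        rw [← he2, smul_eq_mul, smul_eq_mul] at g2
        rw [← neg_sub (w s) (γ s), map_neg, norm_neg, ← hNdef] at hws
        have g3 := mul_le_mul_of_nonneg_left hws.le hτ0
        have g4 : τ * (2 * ε * N) = 2 * ε * (h * χ s) := by rw [← hτN]; ring
        nlinarith
    · push Not at hs
      have hz := hχz s hs
      rw [hηeq s hz, hz]
      simp [hγ s, hh.le]
  obtain ⟨t, ht⟩ := hE η (fun t => (claim t).1) (hηeq 0 (hχz 0 h0)) (hηeq 1 (hχz 1 h1))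
  have hd : dist γ η ≤ h := (ContinuousMap.dist_le hh.le).2 fun s => (claim s).2.1
  have hd' : S - ε * h ≤ ψ (η t) - G (η t) := by
    have := mul_le_mul_of_nonneg_left hd hε.le
    linarith
  have hc := (claim t).2.2
  have hpos : 0 < ε * h := by positivity
  by_cases hs : S - δ / 2 ≤ ψ (γ t) - G (γ t)
  · rw [hχo t hs] at hc
    have := hS t
    linarith
  · push Not at hs
    have : 0 ≤ ε * (h * χ t) := mul_nonneg hε.le (mul_nonneg hh.le (hχ0 t))
    linarith

lemma mid_aux {E : Type*} [NormedAddCommGroup E] [NormedSpace ℝ E] [CompleteSpace E]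
    (D : Set E) (hD : IsClosed D) (ψ G : E → ℝ) (hconv : ConvexOn ℝ D ψ)
    (hcont : ContinuousOn ψ D)
    (hG : ContDiff ℝ 1 G) (γ : C(unitInterval, E)) (hγ : ∀ t, γ t ∈ D)
    (c δ : ℝ) (hδ : 0 < δ) (hδc : δ < c) (hS : ∀ t, ψ (γ t) - G (γ t) ≤ c + δ)
    (h0 : ψ (γ 0) - G (γ 0) ≤ 0) (h1 : ψ (γ 1) - G (γ 1) ≤ 0)
    (hinf : ∀ η : C(unitInterval, E), (∀ t, η t ∈ D) → η 0 = γ 0 → η 1 = γ 1 →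
      c ≤ ⨆ t, (ψ (η t) - G (η t))) :
    ∃ u ∈ D, c - δ ≤ ψ u - G u ∧ ψ u - G u ≤ c + δ ∧ ∀ v ∈ D,
      ψ u - ψ v - fderiv ℝ G u (u - v) ≤ 2 * δ * ‖u - v‖ := by
  let X : Set C(unitInterval, E) := {η | (∀ t, η t ∈ D) ∧ η 0 = γ 0 ∧ η 1 = γ 1}
  have hev : ∀ t : unitInterval, Continuous fun η : C(unitInterval, E) => η t := fun t =>
    continuous_eval_const t
  have hX : IsClosed X := by
    refine IsClosed.inter ?_ (IsClosed.inter ?_ ?_)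
    · have : {η : C(unitInterval, E) | ∀ t, η t ∈ D} = ⋂ t, (fun η => η t) ⁻¹' D := by
        ext; simp
      change IsClosed {η : C(unitInterval, E) | ∀ t, η t ∈ D}
      rw [this]
      exact isClosed_iInter fun t => hD.preimage (hev t)
    · exact isClosed_eq (hev 0) continuous_const
    · exact isClosed_eq (hev 1) continuous_const
  have : CompleteSpace X := hX.completeSpace_coe
  have hJc : ∀ η : X, Continuous fun t => ψ (η.1 t) - G (η.1 t) := fun η =>
    (hcont.comp_continuous η.1.continuous η.2.1).sub (hG.continuous.comp η.1.continuous)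
  have hbdd : ∀ η : X, BddAbove (Set.range fun t => ψ (η.1 t) - G (η.1 t)) := fun η =>
    (isCompact_range (hJc η)).bddAbove
  let Φ : X → ℝ := fun η => ⨆ t, (ψ (η.1 t) - G (η.1 t))
  have hlsc : LowerSemicontinuous Φ := by
    refine lowerSemicontinuous_ciSup hbdd fun t => Continuous.lowerSemicontinuous ?_
    have he : Continuous fun η : X => η.1 t := (hev t).comp continuous_subtype_val
    exact (hcont.comp_continuous he fun η => η.2.1 t).sub (hG.continuous.comp he)
  have hlow : ∀ η : X, c ≤ Φ η := fun η => hinf η.1 η.2.1 η.2.2.1 η.2.2.2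
  obtain ⟨α, hα1, hα2⟩ := ekeland_aux Φ hlsc c hlow δ hδ ⟨γ, hγ, rfl, rfl⟩
  have hγc : Φ ⟨γ, hγ, rfl, rfl⟩ ≤ c + δ := ciSup_le hS
  have hαc := hlow α
  obtain ⟨t, ht, htv⟩ := core_aux D ψ G hconv hcont hG α.1 α.2.1 (Φ α) δ δ hδ hδ
    (fun t => le_ciSup (hbdd α) t)
    (by rw [α.2.2.1]; linarith) (by rw [α.2.2.2]; linarith)
    (by
      intro η hη hη0 hη1
      let β : X := ⟨η, hη, hη0.trans α.2.2.1, hη1.trans α.2.2.2⟩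
      obtain ⟨t, -, ht⟩ := isCompact_univ.exists_isMaxOn Set.univ_nonempty (hJc β).continuousOn
      refine ⟨t, (hα2 β).trans ?_⟩
      exact ciSup_le fun s => ht (Set.mem_univ s))
  exact ⟨α.1 t, α.2.1 t, by linarith,
    (le_ciSup (hbdd α) t).trans (hα1.trans hγc), htv⟩

lemma zero_aux {E : Type*} [NormedAddCommGroup E] [NormedSpace ℝ E]
    (D : Set E) (ψ G : E → ℝ) (hconv : ConvexOn ℝ D ψ)
    (hG : ContDiff ℝ 1 G) (h0D : (0 : E) ∈ D) (h0 : ψ 0 - G 0 = 0) (ρ : ℝ) (hρ : 0 < ρ)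
    (hpos : ∀ u ∈ D, ‖u‖ ≤ ρ → 0 ≤ ψ u - G u) (v : E) (hv : v ∈ D) :
    ψ 0 - ψ v - fderiv ℝ G 0 (0 - v) ≤ 0 := by
  have hd : HasDerivAt (fun t : ℝ => G (t • v)) (fderiv ℝ G 0 v) 0 := by
    have h1 : HasFDerivAt G (fderiv ℝ G 0) ((0:ℝ) • v) := by
      rw [zero_smul]
      exact (hG.differentiable (by norm_num) 0).hasFDerivAt
    have h2 : HasDerivAt (fun t : ℝ => t • v) v 0 := by
      simpa using (hasDerivAt_id (0:ℝ)).smul_const v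
    exact h1.comp_hasDerivAt (0:ℝ) h2
  have key : fderiv ℝ G 0 v ≤ ψ v - ψ 0 := by
    refine le_of_tendsto hd.tendsto_slope_zero_right ?_
    have e1 : ∀ᶠ t : ℝ in 𝓝[>] 0, t < 1 := nhdsWithin_le_nhds (gt_mem_nhds one_pos)
    have e2 : ∀ᶠ t : ℝ in 𝓝[>] 0, ‖t • v‖ < ρ := by
      refine nhdsWithin_le_nhds ?_
      have : ContinuousAt (fun t : ℝ => ‖t • v‖) 0 := by fun_prop
      exact this.eventually_lt continuousAt_const (by simpa using hρ)
    filter_upwards [e1, e2, self_mem_nhdsWithin] with t ht1 ht2 ht0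
    have ht0 : 0 < t := ht0
    have hc := hconv.2 hv h0D ht0.le (by linarith : 0 ≤ 1 - t) (by ring)
    have hm := hconv.1 hv h0D ht0.le (by linarith : 0 ≤ 1 - t) (by ring)
    rw [smul_zero, add_zero] at hc hm
    have := hpos _ hm ht2.le
    simp only [smul_eq_mul, zero_add, zero_smul] at hc ⊢
    rw [inv_mul_le_iff₀ ht0]
    nlinarith
  rw [zero_sub, map_neg]
  linarith

/-- Nonsmooth mountain pass theorem without compactness (Livrea–Marano type).
E is a real Banach space, Ψ : E → (−∞,∞] proper convex with closed domain and
continuous restriction to its domain, 𝒢 ∈ C¹(E;ℝ), I := Ψ − 𝒢. If I(0) = 0,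
I > 0 on the punctured ball of radius ρ, and I(e) ≤ 0 for some ‖e‖ > ρ, then the
mountain pass level c = inf_{γ∈Γ} sup_{t∈[0,1]} I(γ(t)) is finite and there is a
Palais–Smale sequence at level c in Szulkin's sense. -/
theorem stmt_0 {E : Type*} [NormedAddCommGroup E] [NormedSpace ℝ E] [CompleteSpace E]
    (Ψ : E → EReal) (G : E → ℝ)
    (hΨbot : ∀ v : E, Ψ v ≠ ⊥)
    (hΨproper : ∃ v : E, Ψ v ≠ ⊤)
    (hΨconvex : ∀ x y : E, ∀ t : ℝ, 0 ≤ t → t ≤ 1 →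
      Ψ (t • x + (1 - t) • y) ≤ (t : EReal) * Ψ x + ((1 - t : ℝ) : EReal) * Ψ y)
    (hG : ContDiff ℝ 1 G)
    (I : E → EReal) (hI : I = fun u => Ψ u - ((G u : ℝ) : EReal))
    (hDomClosed : IsClosed {v : E | Ψ v ≠ ⊤})
    (hΨcont : ContinuousOn Ψ {v : E | Ψ v ≠ ⊤})
    (ρ : ℝ) (hρ : 0 < ρ)
    (hI0 : I 0 = 0)
    (hIpos : ∀ u : E, 0 < ‖u‖ → ‖u‖ ≤ ρ → 0 < I u)
    (e : E) (he : ρ < ‖e‖) (hIe : I e ≤ 0)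
    (Γ : Set C(unitInterval, E))
    (hΓ : Γ = {γ : C(unitInterval, E) | γ 0 = 0 ∧ γ 1 ≠ 0 ∧ I (γ 1) ≤ 0})
    (c : EReal) (hc : c = ⨅ γ ∈ Γ, ⨆ t : unitInterval, I (γ t)) :
    (∃ creal : ℝ, c = (creal : EReal)) ∧
    ∃ (u : ℕ → E) (ε : ℕ → ℝ),
      (∀ n, Ψ (u n) ≠ ⊤) ∧
      (∀ n, 0 ≤ ε n) ∧
      Tendsto ε atTop (𝓝 0) ∧
      Tendsto (fun n => I (u n)) atTop (𝓝 c) ∧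
      ∀ n, ∀ v : E,
        Ψ (u n) - Ψ v - (((fderiv ℝ G (u n)) (u n - v) : ℝ) : EReal) ≤
          ((ε n * ‖u n - v‖ : ℝ) : EReal) := by
  set D : Set E := {v : E | Ψ v ≠ ⊤} with hDdef
  set ψ : E → ℝ := fun v => (Ψ v).toReal with hψ
  have hcoe : ∀ v ∈ D, Ψ v = (ψ v : EReal) := fun v hv =>
    (EReal.coe_toReal hv (hΨbot v)).symm
  have hDmem : ∀ v, v ∈ D ↔ Ψ v ≠ ⊤ := fun v => Iff.rfl
  have hIcoe : ∀ v ∈ D, I v = ((ψ v - G v : ℝ) : EReal) := by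
    intro v hv
    rw [hI, EReal.coe_sub, ← hcoe v hv]
  have hItop : ∀ v, v ∉ D → I v = ⊤ := by
    intro v hv
    have : Ψ v = ⊤ := not_not.1 hv
    rw [hI]
    simp only [this]
    exact EReal.top_sub_coe _
  have hDI : ∀ v, I v ≠ ⊤ → v ∈ D := fun v hv => by
    by_contra h
    exact hv (hItop v h)
  have hconv2 : ∀ x ∈ D, ∀ y ∈ D, ∀ t : ℝ, 0 ≤ t → t ≤ 1 →
      Ψ (t • x + (1 - t) • y) ≤ ((t * ψ x + (1 - t) * ψ y : ℝ) : EReal) := by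
    intro x hx y hy t h0 h1
    have := hΨconvex x y t h0 h1
    rw [hcoe x hx, hcoe y hy] at this
    exact_mod_cast this
  have hconvD : ∀ x ∈ D, ∀ y ∈ D, ∀ t : ℝ, 0 ≤ t → t ≤ 1 → t • x + (1 - t) • y ∈ D :=
    fun x hx y hy t h0 h1 => ((hconv2 x hx y hy t h0 h1).trans_lt (EReal.coe_lt_top _)).ne
  have hconv : ConvexOn ℝ D ψ := by
    refine ⟨?_, ?_⟩
    · intro x hx y hy a b ha hb hab
      obtain rfl : b = 1 - a := by linarith
      exact hconvD x hx y hy a ha (by linarith)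
    · intro x hx y hy a b ha hb hab
      obtain rfl : b = 1 - a := by linarith
      have h1 := hconv2 x hx y hy a ha (by linarith)
      rw [hcoe _ (hconvD x hx y hy a ha (by linarith))] at h1
      simpa using EReal.coe_le_coe_iff.1 h1
  have hcont : ContinuousOn ψ D := by
    intro x hx
    exact (EReal.tendsto_toReal hx (hΨbot x)).comp (hΨcont x hx)
  have h0D : (0 : E) ∈ D := hDI 0 (by rw [hI0]; exact EReal.zero_ne_top)
  have heD : e ∈ D := hDI e (ne_top_of_le_ne_top EReal.zero_ne_top hIe)
  have hJ0 : ψ 0 - G 0 = 0 := by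
    have := hIcoe 0 h0D
    rw [hI0] at this
    exact_mod_cast this.symm
  have he0 : e ≠ 0 := fun h => by
    rw [h, norm_zero] at he
    linarith
  -- finiteness
  have hc0 : 0 ≤ c := by
    rw [hc]
    refine le_iInf₂ fun γ hγ => ?_
    rw [hΓ] at hγ
    refine le_iSup_of_le 0 ?_
    rw [hγ.1, hI0]
  have hctop : c ≠ ⊤ := by
    let γ : C(unitInterval, E) := ⟨fun t => (t : ℝ) • e, by fun_prop⟩
    have hγD : ∀ t, γ t ∈ D := fun t => by
      have := hconvD e heD 0 h0D t t.2.1 t.2.2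
      rw [smul_zero, add_zero] at this
      exact this
    have hγΓ : γ ∈ Γ := by
      rw [hΓ]
      refine ⟨by simp [γ], by simpa [γ] using he0, by simpa [γ] using hIe⟩
    have hJc : Continuous fun t => ψ (γ t) - G (γ t) :=
      (hcont.comp_continuous γ.continuous hγD).sub (hG.continuous.comp γ.continuous)
    obtain ⟨B, hB⟩ := (isCompact_range hJc).bddAbove
    have : c ≤ (B : EReal) := by
      rw [hc]
      refine (iInf₂_le γ hγΓ).trans (iSup_le fun t => ?_)
      rw [hIcoe _ (hγD t)]
      exact EReal.coe_le_coe_iff.2 (hB ⟨t, rfl⟩)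
    exact (this.trans_lt (EReal.coe_lt_top _)).ne
  have hcbot : c ≠ ⊥ := fun h => by
    rw [h] at hc0
    exact absurd hc0 (not_le.2 EReal.bot_lt_zero)
  obtain ⟨r, hr⟩ : ∃ r : ℝ, c = (r : EReal) := ⟨c.toReal, (EReal.coe_toReal hctop hcbot).symm⟩
  refine ⟨⟨r, hr⟩, ?_⟩
  have hr0 : 0 ≤ r := by
    rw [hr] at hc0
    exact_mod_cast hc0
  have hfin : ∀ u ∈ D, ∀ a : ℝ,
      (∀ v ∈ D, ψ u - ψ v - fderiv ℝ G u (u - v) ≤ a * ‖u - v‖) → ∀ v : E,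
        Ψ u - Ψ v - (((fderiv ℝ G u) (u - v) : ℝ) : EReal) ≤ ((a * ‖u - v‖ : ℝ) : EReal) := by
    intro u hu a ha v
    by_cases hv : v ∈ D
    · rw [hcoe u hu, hcoe v hv, ← EReal.coe_sub, ← EReal.coe_sub]
      exact EReal.coe_le_coe_iff.2 (ha v hv)
    · have : Ψ v = ⊤ := not_not.1 hv
      rw [this, EReal.sub_top, EReal.bot_sub]
      exact bot_le
  rcases hr0.eq_or_lt with hrz | hrpos
  · -- the case of level zero: the origin is a local minimum
    refine ⟨fun _ => 0, fun _ => 0, fun _ => h0D, fun _ => le_rfl, tendsto_const_nhds, ?_, ?_⟩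
    · simp only [hI0]
      rw [hr, ← hrz]
      exact tendsto_const_nhds
    · intro n
      refine hfin 0 h0D 0 fun v hv => ?_
      rw [zero_mul]
      refine zero_aux D ψ G hconv hG h0D hJ0 ρ hρ (fun u hu huρ => ?_) v hv
      rcases (norm_nonneg u).eq_or_lt with hn | hn
      · rw [norm_eq_zero.1 hn.symm, hJ0]
      · have := hIpos u hn huρ
        rw [hIcoe u hu] at this
        exact (by exact_mod_cast this : (0:ℝ) < ψ u - G u).le
  · have step : ∀ δ : ℝ, 0 < δ → δ < r → ∃ u ∈ D, r - δ ≤ ψ u - G u ∧ ψ u - G u ≤ r + δ ∧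
        ∀ v ∈ D, ψ u - ψ v - fderiv ℝ G u (u - v) ≤ 2 * δ * ‖u - v‖ := by
      intro δ hδ hδr
      have hlt : c < ((r + δ : ℝ) : EReal) := by
        rw [hr]
        exact EReal.coe_lt_coe_iff.2 (by linarith)
      rw [hc] at hlt
      obtain ⟨γ, hlt⟩ := iInf_lt_iff.1 hlt
      obtain ⟨hγ, hlt⟩ := iInf_lt_iff.1 hlt
      rw [hΓ] at hγ
      obtain ⟨hγ0, hγ1, hγI⟩ := hγ
      have hle : ∀ t, I (γ t) ≤ ((r + δ : ℝ) : EReal) := fun t =>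
        (le_iSup (fun t => I (γ t)) t).trans hlt.le
      have hγD : ∀ t, γ t ∈ D := fun t =>
        hDI _ ((hle t).trans_lt (EReal.coe_lt_top _)).ne
      refine mid_aux D hDomClosed ψ G hconv hcont hG γ hγD r δ hδ hδr (fun t => ?_) ?_ ?_ ?_
      · have := hle t
        rw [hIcoe _ (hγD t)] at this
        exact EReal.coe_le_coe_iff.1 this
      · rw [hγ0, hJ0]
      · rw [hIcoe _ (hγD 1)] at hγI
        exact_mod_cast hγI
      · intro η hη hη0 hη1
        have hJc : Continuous fun t => ψ (η t) - G (η t) :=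
          (hcont.comp_continuous η.continuous hη).sub (hG.continuous.comp η.continuous)
        have hbdd := (isCompact_range hJc).bddAbove
        have hηΓ : η ∈ Γ := by
          rw [hΓ]
          exact ⟨hη0.trans hγ0, by rwa [hη1], by rwa [hη1]⟩
        rw [← EReal.coe_le_coe_iff, ← hr, hc]
        refine (iInf₂_le η hηΓ).trans (iSup_le fun t => ?_)
        rw [hIcoe _ (hη t)]
        exact EReal.coe_le_coe_iff.2 (le_ciSup hbdd t)
    let δ : ℕ → ℝ := fun n => min (r / 2) (1 / ((n : ℝ) + 1))
    have hδ0 : ∀ n, 0 < δ n := fun n => lt_min (by linarith) (by positivity)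
    have hδr : ∀ n, δ n < r := fun n => (min_le_left _ _).trans_lt (by linarith)
    have hδt : Tendsto δ atTop (𝓝 0) :=
      squeeze_zero (fun n => (hδ0 n).le) (fun n => min_le_right _ _)
        tendsto_one_div_add_atTop_nhds_zero_nat
    choose u huD hu1 hu2 hu3 using fun n => step (δ n) (hδ0 n) (hδr n)
    refine ⟨u, fun n => 2 * δ n, huD, fun n => by have := hδ0 n; positivity, ?_, ?_, ?_⟩
    · simpa using hδt.const_mul 2
    · have : (fun n => I (u n)) = fun n => ((ψ (u n) - G (u n) : ℝ) : EReal) :=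
        funext fun n => hIcoe _ (huD n)
      rw [this, hr]
      refine EReal.tendsto_coe.2 ?_
      refine tendsto_of_tendsto_of_tendsto_of_le_of_le (g := fun n => r - δ n)
        (h := fun n => r + δ n) ?_ ?_ hu1 hu2
      · simpa using hδt.const_sub r
      · simpa using hδt.const_add r
    · exact fun n => hfin (u n) (huD n) (2 * δ n) (hu3 n)
end

section
/- Let β > 0 be a real number and m ≥ 1 an integer. For every s > 0, the function s ↦ s^{β−1} exp_m(s^β) is differentiable at s with derivative (β−1) s^{β−2} exp_m(s^β) + β s^{2β−2} exp_{m−1}(s^β), where exp_m(t) := e^t − ∑_{i=0}^{m−1} t^i / i!. Moreover, if in addition β(m+1) ≥ 1, then this derivative satisfies (β−1) s^{β−2} exp_m(s^β) + β s^{2β−2} exp_{m−1}(s^β) ≥ (β(m+1) − 1) s^{β−2} exp_m(s^β) ≥ 0 for every s > 0. -/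
/-- exp_m(t) := e^t − ∑_{i=0}^{m−1} t^i / i!. -/
noncomputable def expm (m : ℕ) (t : ℝ) : ℝ :=
  Real.exp t - ∑ i ∈ Finset.range m, t ^ i / (Nat.factorial i)

theorem expm_succ_hasDerivAt (n : ℕ) (t : ℝ) :
    HasDerivAt (expm (n + 1)) (expm n t) t := by
  induction n with
  | zero =>
    have h := (Real.hasDerivAt_exp t).sub_const 1
    have e : expm (0 + 1) = fun x => Real.exp x - 1 := by
      funext x; simp [expm]
    rw [e]
    simpa [expm] using h
  | succ n ih =>
    have e : expm (n + 1 + 1) = fun x => expm (n + 1) x - x ^ (n + 1) / ((n + 1).factorial : ℝ) := by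
      funext x
      simp only [expm]
      rw [Finset.sum_range_succ _ (n + 1)]
      ring
    rw [e]
    have h := ih.sub ((hasDerivAt_pow (n + 1) t).div_const ((n + 1).factorial : ℝ))
    refine h.congr_deriv ?_
    simp only [expm]
    rw [Finset.sum_range_succ _ n, Nat.factorial_succ]
    have : (n.factorial : ℝ) ≠ 0 := by positivity
    have h2 : ((n : ℝ) + 1) ≠ 0 := by positivity
    push_cast
    field_simp
    ring

theorem expm_succ_zero (n : ℕ) : expm (n + 1) 0 = 0 := by
  simp only [expm]
  rw [Finset.sum_range_succ']
  simp

theorem nonneg_of_deriv_aux (f f' : ℝ → ℝ) (hf : ∀ t, HasDerivAt f (f' t) t) (h0 : f 0 = 0)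
    (h' : ∀ t, 0 ≤ t → 0 ≤ f' t) (t : ℝ) (ht : 0 ≤ t) : 0 ≤ f t := by
  have hm : MonotoneOn f (Set.Ici 0) := by
    apply monotoneOn_of_deriv_nonneg (convex_Ici 0)
    · exact fun x _ => (hf x).continuousAt.continuousWithinAt
    · exact fun x _ => (hf x).differentiableAt.differentiableWithinAt
    · intro x hx
      rw [(hf x).deriv]
      rw [interior_Ici] at hx
      exact h' x (le_of_lt hx)
  have := hm (Set.mem_Ici.2 le_rfl) (Set.mem_Ici.2 ht) ht
  rwa [h0] at this

theorem expm_nonneg_aux (n : ℕ) : ∀ t : ℝ, 0 ≤ t → 0 ≤ expm n t := by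
  induction n with
  | zero => intro t _; simp [expm, Real.exp_nonneg]
  | succ n ih => exact nonneg_of_deriv_aux _ _ (expm_succ_hasDerivAt n) (expm_succ_zero n) ih

theorem expm_ineq_aux (n : ℕ) : ∀ t : ℝ, 0 ≤ t →
    0 ≤ t * expm n t - ((n : ℝ) + 1) * expm (n + 1) t := by
  induction n with
  | zero =>
    refine nonneg_of_deriv_aux _ (fun t => t * expm 0 t) (fun t => ?_) ?_ ?_
    · have e : expm 0 = Real.exp := by funext x; simp [expm]
      have h := ((hasDerivAt_id t).mul (Real.hasDerivAt_exp t)).sub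
        ((expm_succ_hasDerivAt 0 t).const_mul (((0 : ℕ) : ℝ) + 1))
      rw [e] at *
      refine h.congr_deriv ?_
      simp
    · simp [expm_succ_zero 0]
    · exact fun t ht => mul_nonneg ht (expm_nonneg_aux 0 t ht)
  | succ n ih =>
    refine nonneg_of_deriv_aux _ _ (fun t => ?_) ?_ ih
    · have h := ((hasDerivAt_id t).mul (expm_succ_hasDerivAt n t)).sub
        ((expm_succ_hasDerivAt (n + 1) t).const_mul (((n + 1 : ℕ) : ℝ) + 1))
      refine h.congr_deriv ?_
      push_cast
      simp only [id]
      ring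
    · simp [expm_succ_zero]

/-- Let β > 0 be real and m ≥ 1 an integer. For every s > 0 the function
s ↦ s^{β−1} exp_m(s^β) is differentiable at s with derivative
(β−1) s^{β−2} exp_m(s^β) + β s^{2β−2} exp_{m−1}(s^β); moreover, if β(m+1) ≥ 1,
then this derivative is bounded below by (β(m+1)−1) s^{β−2} exp_m(s^β) ≥ 0. -/
theorem stmt_15 (β : ℝ) (hβ : 0 < β) (m : ℕ) (hm : 1 ≤ m) :
    (∀ s : ℝ, 0 < s →
      HasDerivAt (fun s : ℝ => s ^ (β - 1) * expm m (s ^ β))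
        ((β - 1) * s ^ (β - 2) * expm m (s ^ β)
          + β * s ^ (2 * β - 2) * expm (m - 1) (s ^ β)) s) ∧
    (β * (m + 1) ≥ 1 → ∀ s : ℝ, 0 < s →
      (β * (m + 1) - 1) * s ^ (β - 2) * expm m (s ^ β) ≤
          (β - 1) * s ^ (β - 2) * expm m (s ^ β)
            + β * s ^ (2 * β - 2) * expm (m - 1) (s ^ β) ∧
      0 ≤ (β * (m + 1) - 1) * s ^ (β - 2) * expm m (s ^ β)) := by
  obtain ⟨n, rfl⟩ : ∃ n, m = n + 1 := ⟨m - 1, by omega⟩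
  simp only [Nat.add_sub_cancel]
  have key : ∀ s : ℝ, 0 < s → s ^ (2 * β - 2) = s ^ (β - 2) * s ^ β := by
    intro s hs
    rw [← Real.rpow_add hs]; ring_nf
  refine ⟨fun s hs => ?_, fun hb s hs => ?_⟩
  · have h1 := Real.hasDerivAt_rpow_const (x := s) (p := β - 1) (Or.inl hs.ne')
    have h2 := Real.hasDerivAt_rpow_const (x := s) (p := β) (Or.inl hs.ne')
    have h3 := (expm_succ_hasDerivAt n (s ^ β)).comp s h2
    refine (h1.mul h3).congr_deriv ?_
    have k2 : s ^ (2 * β - 2) = s ^ (β - 1) * s ^ (β - 1) := by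
      rw [← Real.rpow_add hs]; ring_nf
    have k3 : β - 1 - 1 = β - 2 := by ring
    rw [k2, k3]
    simp only [Function.comp]
    ring
  · have ht : 0 ≤ s ^ β := Real.rpow_nonneg hs.le _
    have hp : 0 ≤ s ^ (β - 2) := Real.rpow_nonneg hs.le _
    refine ⟨?_, mul_nonneg (mul_nonneg (by linarith) hp) (expm_nonneg_aux _ _ ht)⟩
    rw [key s hs]
    have h := mul_nonneg (mul_nonneg hβ.le hp) (expm_ineq_aux n _ ht)
    push_cast
    nlinarith [h]
end
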